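/- Let (Ω, F, P) be a probability space and Y = (Y_t)_{t≥0} a jointly measurable real-valued stochastic process such that there is an even function r : ℝ → ℝ with r(0) = 1 and, for all s, t ≥ 0 and all c, d ∈ ℝ, the random variable c·Y_s + d·Y_t is centered Gaussian with variance c² + d² + 2cd·r(t − s); write c(t) = 2·(1 − r(t)). Assume r(T) → 0 as T → ∞ and sup_{0≤s≤t} c(s) → 0 as t → 0. Let α₊, α₋ > 0 with α₊ ≠ α₋ and X_t = α₊·Y_t·1_{Y_t>0} + α₋·Y_t·1_{Y_t<0}. For each N, let 0 = t₀ < t₁ < ⋯ < t_N = T_N be a partition with Δ_N = max_k(t_k − t_{k−1}), and define μ̃_i(N) = (1/T_N)·Σ_{k=1}^N X_{t_{k−1}}^i·(t_k − t_{k−1}) for i = 1, 2, α̃₊(N) = √(π/2)·μ̃₁(N) + (1/2)·√|4μ̃₂(N) − 2π·μ̃₁(N)²| and α̃₋(N) = −√(π/2)·μ̃₁(N) + (1/2)·√|4μ̃₂(N) − 2π·μ̃₁(N)²|. If T_N → ∞ and Δ_N → 0 as N → ∞, then for every p ≥ 1, α̃₊(N) → α₊ and α̃₋(N) → α₋ in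 L^p(P). -/

import Mathlib

open MeasureTheory ProbabilityTheory Real Filter Set

lemma map_prodMk_eq_of_gaussian_comb {Ω : Type*} [MeasurableSpace Ω] (P : Measure Ω)
    [IsProbabilityMeasure P] {U V : Ω → ℝ} (hU : Measurable U) (hV : Measurable V) {ρ : ℝ}
    (hρ : |ρ| ≤ 1)
    (h : ∀ c d : ℝ, P.map (fun ω => c * U ω + d * V ω)
      = gaussianReal 0 (Real.toNNReal (c ^ 2 + d ^ 2 + 2 * c * d * ρ))) :
    P.map (fun ω => (U ω, V ω)) = ((gaussianReal 0 1).prod (gaussianReal 0 1)).map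
      (fun z => (z.1, ρ * z.1 + √(1 - ρ ^ 2) * z.2)) := by
  have hm : Measurable (fun ω => (U ω, V ω)) := hU.prodMk hV
  have hm' : Measurable (fun z : ℝ × ℝ => (z.1, ρ * z.1 + √(1 - ρ ^ 2) * z.2)) := by fun_prop
  have := Measure.isProbabilityMeasure_map (μ := P) hm.aemeasurable
  have := Measure.isProbabilityMeasure_map
    (μ := (gaussianReal 0 1).prod (gaussianReal 0 1)) hm'.aemeasurable
  have key : ∀ L : StrongDual ℝ (ℝ × ℝ), ∃ c d : ℝ, ∀ z, L z = c * z.1 + d * z.2 := by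
    intro L
    refine ⟨L (1, 0), L (0, 1), fun z => ?_⟩
    have : z = z.1 • ((1 : ℝ), (0 : ℝ)) + z.2 • ((0 : ℝ), (1 : ℝ)) := by ext <;> simp
    conv_lhs => rw [this, map_add, map_smul, map_smul]
    simp [mul_comm]
  have hσ : √(1 - ρ ^ 2) ^ 2 = 1 - ρ ^ 2 := Real.sq_sqrt (by nlinarith [abs_le.1 hρ])
  have ind : IndepFun (fun z : ℝ × ℝ => z.1) (fun z : ℝ × ℝ => z.2)
      ((gaussianReal 0 1).prod (gaussianReal 0 1)) :=
    indepFun_prod measurable_id measurable_id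
  refine Measure.ext_of_charFunDual (funext fun L => ?_)
  obtain ⟨c, d, hL⟩ := key L
  rw [charFunDual_eq_charFun_map_one, charFunDual_eq_charFun_map_one]
  congr 1
  rw [Measure.map_map L.continuous.measurable hm, Measure.map_map L.continuous.measurable hm']
  have e1 : (⇑L ∘ fun ω => (U ω, V ω)) = fun ω => c * U ω + d * V ω := by
    ext ω; simp [hL]
  have e2 : (⇑L ∘ fun z : ℝ × ℝ => (z.1, ρ * z.1 + √(1 - ρ ^ 2) * z.2))
      = (fun z : ℝ × ℝ => (c + d * ρ) * z.1) + (fun z : ℝ × ℝ => (d * √(1 - ρ ^ 2)) * z.2) := by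
    ext ω; simp [hL]; ring
  have hfst : ∀ a : ℝ, ((gaussianReal 0 1).prod (gaussianReal 0 1)).map
      (fun z : ℝ × ℝ => a * z.1) = gaussianReal 0 (a ^ 2).toNNReal := by
    intro a
    rw [show (fun z : ℝ × ℝ => a * z.1) = (fun x => a * x) ∘ Prod.fst from rfl,
      ← Measure.map_map (by fun_prop) measurable_fst, Measure.map_fst_prod]
    rw [measure_univ, one_smul, gaussianReal_map_const_mul, mul_zero, mul_one,
      ← Real.toNNReal_of_nonneg]
  have hsnd : ∀ a : ℝ, ((gaussianReal 0 1).prod (gaussianReal 0 1)).map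
      (fun z : ℝ × ℝ => a * z.2) = gaussianReal 0 (a ^ 2).toNNReal := by
    intro a
    rw [show (fun z : ℝ × ℝ => a * z.2) = (fun x => a * x) ∘ Prod.snd from rfl,
      ← Measure.map_map (by fun_prop) measurable_snd, Measure.map_snd_prod]
    rw [measure_univ, one_smul, gaussianReal_map_const_mul, mul_zero, mul_one,
      ← Real.toNNReal_of_nonneg]
  rw [e1, e2, h]
  refine Eq.trans ?_ (gaussianReal_add_gaussianReal_of_indepFun
    (ind.comp (measurable_const_mul (c + d * ρ)) (measurable_const_mul (d * √(1 - ρ ^ 2))))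
    (hfst _) (hsnd _)).symm
  congr 1
  · simp
  · ext
    rw [NNReal.coe_add, Real.coe_toNNReal', Real.coe_toNNReal _ (sq_nonneg _),
      Real.coe_toNNReal _ (sq_nonneg _)]
    have : (c + d * ρ) ^ 2 + (d * √(1 - ρ ^ 2)) ^ 2 = c ^ 2 + d ^ 2 + 2 * c * d * ρ := by
      rw [mul_pow, hσ]; ring
    rw [this, max_eq_left]
    rw [← this]; positivity

lemma integrable_one_add_sq_pow_gaussianReal (n : ℕ) :
    Integrable (fun x : ℝ => (1 + x ^ 2) ^ n) (gaussianReal 0 1) := by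
  have h : ∀ k : ℕ, Integrable (fun x : ℝ => x ^ k) (gaussianReal 0 1) := fun k => by
    have := (memLp_id_gaussianReal (μ := 0) (v := 1) k).integrable_norm_pow'
    refine this.mono' (by fun_prop) (by simp)
  simp_rw [add_comm (1 : ℝ), add_pow, ← pow_mul]
  exact integrable_finsetSum _ fun i _ => by simpa using (h _).mul_const _

lemma tendsto_integral_mul_gaussian_pair {h : ℝ → ℝ} (hc : Continuous h) {K : ℝ}
    (hK : ∀ x, |h x| ≤ K * (1 + x ^ 2)) :
    Tendsto (fun ρ : ℝ => ∫ z : ℝ × ℝ, h z.1 * h (ρ * z.1 + √(1 - ρ ^ 2) * z.2)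
      ∂(gaussianReal 0 1).prod (gaussianReal 0 1)) (nhds 0)
      (nhds ((∫ x, h x ∂gaussianReal 0 1) ^ 2)) := by
  have hlim : (∫ x, h x ∂gaussianReal 0 1) ^ 2
      = ∫ z : ℝ × ℝ, h z.1 * h (0 * z.1 + √(1 - 0 ^ 2) * z.2)
      ∂(gaussianReal 0 1).prod (gaussianReal 0 1) := by
    simp [integral_prod_mul, sq]
  have hK0 : 0 ≤ K := by simpa using (abs_nonneg _).trans (hK 0)
  rw [hlim]
  refine tendsto_integral_filter_of_dominated_convergence
    (fun z => K * (1 + z.1 ^ 2) * (K * (2 * ((1 + z.1 ^ 2) * (1 + z.2 ^ 2))))) ?_ ?_ ?_ ?_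
  · exact Eventually.of_forall fun ρ => Continuous.aestronglyMeasurable (by fun_prop)
  · have : ∀ᶠ ρ : ℝ in nhds 0, ρ ∈ Metric.ball (0 : ℝ) 1 := Metric.ball_mem_nhds _ one_pos
    filter_upwards [this] with ρ hρ
    refine Eventually.of_forall fun z => ?_
    simp only [Metric.mem_ball, dist_zero_right, norm_eq_abs] at hρ
    have hρ2 : ρ ^ 2 ≤ 1 := by nlinarith [abs_lt.1 hρ]
    have hσ : √(1 - ρ ^ 2) ^ 2 = 1 - ρ ^ 2 := Real.sq_sqrt (by linarith)
    rw [norm_mul]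
    refine mul_le_mul (hK _) ((hK _).trans (mul_le_mul_of_nonneg_left ?_ hK0)) (norm_nonneg _)
      (by positivity)
    have : (ρ * z.1 + √(1 - ρ ^ 2) * z.2) ^ 2 ≤ z.1 ^ 2 + z.2 ^ 2 := by
      have : (ρ * z.1 + √(1 - ρ ^ 2) * z.2) ^ 2 + (√(1 - ρ ^ 2) * z.1 - ρ * z.2) ^ 2
        = (ρ ^ 2 + √(1 - ρ ^ 2) ^ 2) * (z.1 ^ 2 + z.2 ^ 2) := by ring
      rw [hσ] at this
      nlinarith [sq_nonneg (√(1 - ρ ^ 2) * z.1 - ρ * z.2)]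
    nlinarith [sq_nonneg (z.1 * z.2), sq_nonneg z.1, sq_nonneg z.2]
  · have := ((integrable_one_add_sq_pow_gaussianReal 2).mul_prod
      (integrable_one_add_sq_pow_gaussianReal 1)).const_mul (2 * K ^ 2)
    refine this.congr (Eventually.of_forall fun z => ?_)
    simp only; ring
  · refine Eventually.of_forall fun z => ?_
    have : Continuous fun ρ : ℝ => h z.1 * h (ρ * z.1 + √(1 - ρ ^ 2) * z.2) := by fun_prop
    exact this.tendsto 0

lemma integral_abs_gaussianReal : √(π / 2) * ∫ x, |x| ∂gaussianReal 0 1 = 1 := by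
  rw [integral_gaussianReal_eq_integral_smul one_ne_zero]
  have h1 : ∫ x : ℝ, gaussianPDFReal 0 1 x • |x|
      = ∫ x : ℝ, (fun y => (√(2 * π))⁻¹ * (y * rexp (-(1 / 2) * y ^ 2))) |x| := by
    congr 1; ext x
    simp [gaussianPDFReal]; ring_nf
  have h2 : ∫ x in Ioi (0 : ℝ), x * rexp (-(1 / 2) * x ^ 2) = 1 := by
    have := integral_rpow_mul_exp_neg_mul_rpow (p := 2) (q := 1) (b := 1 / 2) (by norm_num)
      (by norm_num) (by norm_num)
    norm_num [Real.rpow_neg_one] at this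
    norm_num
    exact this
  rw [h1, integral_comp_abs (f := fun y => (√(2 * π))⁻¹ * (y * rexp (-(1 / 2) * y ^ 2))),
    integral_const_mul, h2, mul_one, mul_left_comm, ← Real.sqrt_inv, ← Real.sqrt_mul (by positivity)]
  rw [show π / 2 * (2 * π)⁻¹ = (1 / 2) ^ 2 by field_simp, Real.sqrt_sq (by norm_num)]
  norm_num

lemma integral_sq_gaussianReal : ∫ x, x ^ 2 ∂gaussianReal 0 1 = 1 := by
  have := variance_fun_id_gaussianReal (μ := 0) (v := 1)
  rw [variance_eq_integral (by fun_prop)] at this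
  simpa using this

lemma integral_eq_zero_of_odd_gaussianReal {g : ℝ → ℝ} (hg : ∀ x, g (-x) = -g x) :
    ∫ x, g x ∂gaussianReal 0 1 = 0 := by
  have h : (gaussianReal 0 1).map (fun x : ℝ => -x) = gaussianReal 0 1 := by
    simp [gaussianReal_map_neg]
  have := (MeasurableEquiv.neg ℝ).measurableEmbedding.integral_map (μ := gaussianReal 0 1) g
  rw [show ⇑(MeasurableEquiv.neg ℝ) = fun x => -x from rfl, h] at this
  simp only [hg, integral_neg] at this
  linarith

lemma sum_increments_near_le {N : ℕ} {t : ℕ → ℝ} (ht : ∀ k < N, t k ≤ t (k + 1)) {δ : ℝ}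
    (hδ0 : 0 ≤ δ) (hδ : ∀ k < N, t (k + 1) - t k ≤ δ) (a : ℝ) {M : ℝ} (hM : 0 ≤ M) :
    ∑ k ∈ Finset.range N, (if |t k - a| < M then t (k + 1) - t k else 0) ≤ 2 * M + δ := by
  set φ : ℝ → ℝ := fun x => min (max x (a - M)) (a + M + δ) with hφ
  have h1 : ∀ k ∈ Finset.range N, (if |t k - a| < M then t (k + 1) - t k else 0)
      ≤ φ (t (k + 1)) - φ (t k) := by
    intro k hk
    have h0 := ht k (Finset.mem_range.1 hk)
    have h1 := hδ k (Finset.mem_range.1 hk)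
    split_ifs with h
    · rw [abs_lt] at h
      simp only [hφ]
      rw [max_eq_left (by linarith), max_eq_left (by linarith), min_eq_left (by linarith),
        min_eq_left (by linarith)]
    · rw [sub_nonneg]
      exact min_le_min_right _ (max_le_max_right _ h0)
  refine (Finset.sum_le_sum h1).trans ?_
  rw [Finset.sum_range_sub (fun k => φ (t k))]
  have h2 : φ (t N) ≤ a + M + δ := min_le_right _ _
  have h3 : a - M ≤ φ (t 0) := le_min (le_max_right _ _) (by linarith)
  linarith

lemma sum_weights_eq_one {N : ℕ} {t : ℕ → ℝ} (ht0 : t 0 = 0) (hT : 0 < t N) :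
    ∑ k ∈ Finset.range N, (t (k + 1) - t k) / t N = 1 := by
  rw [← Finset.sum_div, Finset.sum_range_sub, ht0, sub_zero, div_self hT.ne']

lemma tendsto_double_sum_zero {t : ℕ → ℕ → ℝ} (ht0 : ∀ N, t N 0 = 0)
    (ht : ∀ N, ∀ k < N, t N k ≤ t N (k + 1)) {Δ : ℕ → ℝ}
    (hΔ : ∀ N, ∀ k < N, t N (k + 1) - t N k ≤ Δ N)
    (hT : Tendsto (fun N => t N N) atTop atTop) {B : ℝ} (hB : ∀ᶠ N in atTop, Δ N ≤ B)
    {G : ℕ → ℕ → ℕ → ℝ} {C : ℝ} (hC : ∀ N, ∀ j < N, ∀ k < N, |G N j k| ≤ C)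
    (hG : ∀ ε > 0, ∃ M : ℝ, ∀ N, ∀ j < N, ∀ k < N, M ≤ |t N k - t N j| → |G N j k| ≤ ε) :
    Tendsto (fun N => ∑ j ∈ Finset.range N, ∑ k ∈ Finset.range N,
      (t N (j + 1) - t N j) / t N N * ((t N (k + 1) - t N k) / t N N) * G N j k)
      atTop (nhds 0) := by
  rw [Metric.tendsto_nhds]
  intro ε hε
  obtain ⟨M', hM'⟩ := hG (ε / 4) (by positivity)
  set M := max M' 0
  have hM0 : 0 ≤ M := le_max_right _ _
  set B' := max B 0
  have hB0 : 0 ≤ B' := le_max_right _ _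
  set C' := max C 0
  have hC0 : 0 ≤ C' := le_max_right _ _
  have hlim : Tendsto (fun N => C' * (2 * M + B') / t N N) atTop (nhds 0) := hT.const_div_atTop _
  filter_upwards [hB, hT.eventually_gt_atTop 0, hlim.eventually_lt_const (by positivity : 0 < ε / 4)]
    with N hN hTN hl
  set w : ℕ → ℝ := fun k => (t N (k + 1) - t N k) / t N N with hw
  have hw0 : ∀ k ∈ Finset.range N, 0 ≤ w k := fun k hk =>
    div_nonneg (sub_nonneg.2 (ht N k (Finset.mem_range.1 hk))) hTN.le
  have hw1 : ∑ k ∈ Finset.range N, w k = 1 := sum_weights_eq_one (ht0 N) hTN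
  have hrow : ∀ j ∈ Finset.range N, ∑ k ∈ Finset.range N, w k * |G N j k| ≤ ε / 2 := by
    intro j hj
    have : ∀ k ∈ Finset.range N, w k * |G N j k|
        ≤ w k * (ε / 4) + C' / t N N *
          (if |t N k - t N j| < M then t N (k + 1) - t N k else 0) := by
      intro k hk
      have hjk := hC N j (Finset.mem_range.1 hj) k (Finset.mem_range.1 hk)
      split_ifs with h
      · have : C' / t N N * (t N (k + 1) - t N k) = w k * C' := by simp only [hw]; ring
        rw [this, ← mul_add]
        refine mul_le_mul_of_nonneg_left ?_ (hw0 k hk)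
        have : C ≤ C' := le_max_left _ _
        linarith
      · rw [mul_zero, add_zero]
        exact mul_le_mul_of_nonneg_left (hM' N j (Finset.mem_range.1 hj) k (Finset.mem_range.1 hk)
          ((le_max_left _ _).trans (not_lt.1 h))) (hw0 k hk)
    refine (Finset.sum_le_sum this).trans ?_
    rw [Finset.sum_add_distrib, ← Finset.sum_mul, hw1, ← Finset.mul_sum]
    have h2 := sum_increments_near_le (ht N) hB0 (fun k hk => (hΔ N k hk).trans
      (hN.trans (le_max_left _ _))) (t N j) hM0
    have h3 := mul_le_mul_of_nonneg_left h2 (div_nonneg hC0 hTN.le)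
    rw [div_mul_eq_mul_div C' (t N N) (2 * M + B')] at h3
    linarith
  rw [dist_zero_right, norm_eq_abs]
  refine lt_of_le_of_lt ?_ (half_lt_self hε)
  calc _ ≤ ∑ j ∈ Finset.range N, w j * ∑ k ∈ Finset.range N, w k * |G N j k| := by
        refine (Finset.abs_sum_le_sum_abs _ _).trans (Finset.sum_le_sum fun j hj => ?_)
        rw [Finset.mul_sum]
        refine (Finset.abs_sum_le_sum_abs _ _).trans (Finset.sum_le_sum fun k hk => ?_)
        rw [abs_mul, abs_mul, abs_of_nonneg (hw0 j hj), abs_of_nonneg (hw0 k hk), mul_assoc]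
    _ ≤ ∑ j ∈ Finset.range N, w j * (ε / 2) :=
        Finset.sum_le_sum fun j hj => mul_le_mul_of_nonneg_left (hrow j hj) (hw0 j hj)
    _ = ε / 2 := by rw [← Finset.sum_mul, hw1, one_mul]

lemma tendsto_integral_rpow_of_bounded_moment {Ω : Type*} [MeasurableSpace Ω] (P : Measure Ω)
    [IsProbabilityMeasure P] {f : ℕ → Ω → ℝ} (hf : ∀ n, Measurable (f n))
    (hlim : TendstoInMeasure P f atTop (fun _ => 0)) {p : ℝ} (hp : 1 ≤ p) {m : ℕ}
    (hpm : p + 1 ≤ 2 * m) {C : ℝ}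
    (hC : ∀ᶠ n in atTop, Integrable (fun ω => f n ω ^ (2 * m)) P ∧ ∫ ω, f n ω ^ (2 * m) ∂P ≤ C) :
    Tendsto (fun n => ∫ ω, |f n ω| ^ p ∂P) atTop (nhds 0) := by
  have hp0 : 0 < p := by linarith
  have htrunc : ∀ K : ℝ, 0 ≤ K →
      Tendsto (fun n => ∫ ω, (min |f n ω| K) ^ p ∂P) atTop (nhds 0) := by
    intro K hK
    refine tendsto_of_subseq_tendsto fun ns hns => ?_
    obtain ⟨ms, -, hms⟩ := (hlim.comp hns).exists_seq_tendsto_ae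
    refine ⟨ms, ?_⟩
    have : (0 : ℝ) = ∫ ω, (0 : ℝ) ∂P := by simp
    rw [this]
    refine tendsto_integral_of_dominated_convergence (fun _ => K ^ p) ?_ (integrable_const _) ?_ ?_
    · exact fun n => ((((hf _).abs).min measurable_const).pow_const p).aestronglyMeasurable
    · refine fun n => Eventually.of_forall fun ω => ?_
      have h0 : 0 ≤ min |f (ns (ms n)) ω| K := le_min (abs_nonneg _) hK
      rw [norm_of_nonneg (by positivity)]
      exact rpow_le_rpow h0 (min_le_right _ _) hp0.le
    · filter_upwards [hms] with ω hω
      have hc : Continuous fun x : ℝ => (min |x| K) ^ p :=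
        (continuous_abs.min continuous_const).rpow_const fun _ => Or.inr hp0.le
      have := (hc.tendsto 0).comp hω
      simpa [hK, Real.zero_rpow hp0.ne', Function.comp_def] using this
  have hpt : ∀ K : ℝ, 1 ≤ K → ∀ x : ℝ, |x| ^ p ≤ (min |x| K) ^ p + x ^ (2 * m) / K := by
    intro K hK x
    have hx2 : 0 ≤ x ^ (2 * m) := by rw [pow_mul]; positivity
    rcases le_total |x| K with h | h
    · rw [min_eq_left h]
      have : 0 ≤ x ^ (2 * m) / K := by positivity
      linarith
    · have h1 : |x| ^ p ≤ x ^ (2 * m) / K := by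
        rw [le_div_iff₀ (by linarith)]
        calc |x| ^ p * K ≤ |x| ^ p * |x| := mul_le_mul_of_nonneg_left h (by positivity)
          _ = |x| ^ (p + 1) := by rw [rpow_add_one (by linarith)]
          _ ≤ |x| ^ ((2 * m : ℕ) : ℝ) :=
              rpow_le_rpow_of_exponent_le (by linarith) (by push_cast; exact hpm)
          _ = x ^ (2 * m) := by rw [rpow_natCast, pow_mul, pow_mul, sq_abs]
      have : 0 ≤ min |x| K := le_min (abs_nonneg _) (by linarith)
      have : 0 ≤ (min |x| K) ^ p := by positivity
      linarith
  rw [Metric.tendsto_nhds]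
  intro ε hε
  obtain ⟨K, hK⟩ := exists_nat_gt (max 1 (2 * |C| / ε))
  have hK1 : (1 : ℝ) ≤ K := (le_max_left _ _).trans hK.le
  have hK2 : C / K < ε / 2 := by
    have := (le_max_right _ _).trans_lt hK
    rw [div_lt_iff₀ hε] at this
    rw [div_lt_iff₀ (by linarith)]
    linarith [le_abs_self C]
  filter_upwards [hC, (htrunc K (by linarith)).eventually_lt_const (half_pos hε)] with n hn hn'
  have hnn : 0 ≤ ∫ ω, |f n ω| ^ p ∂P := integral_nonneg fun ω => by positivity
  rw [dist_zero_right, norm_of_nonneg hnn]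
  have hi : Integrable (fun ω => (min |f n ω| K) ^ p) P := by
    refine Integrable.mono' (integrable_const ((K : ℝ) ^ p))
      ((((hf _).abs).min measurable_const).pow_const p).aestronglyMeasurable
      (Eventually.of_forall fun ω => ?_)
    have h0 : 0 ≤ min |f n ω| K := le_min (abs_nonneg _) (by linarith)
    rw [norm_of_nonneg (by positivity)]
    exact rpow_le_rpow h0 (min_le_right _ _) hp0.le
  calc _ ≤ ∫ ω, (min |f n ω| K) ^ p + f n ω ^ (2 * m) / K ∂P :=
        integral_mono_of_nonneg (Eventually.of_forall fun ω => by positivity)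
          (hi.add (hn.1.div_const _)) (Eventually.of_forall fun ω => hpt K hK1 _)
    _ = ∫ ω, (min |f n ω| K) ^ p ∂P + (∫ ω, f n ω ^ (2 * m) ∂P) / K := by
        rw [integral_add hi (hn.1.div_const _), integral_div]
    _ < ε / 2 + ε / 2 := by
        have : (∫ ω, f n ω ^ (2 * m) ∂P) / K ≤ C / K := by gcongr; exact hn.2
        linarith
    _ = ε := by ring

lemma tendstoInMeasure_of_tendsto_integral_sq {Ω : Type*} [MeasurableSpace Ω] (P : Measure Ω)
    {f : ℕ → Ω → ℝ} {a : ℝ} (hf : ∀ n, MemLp (fun ω => f n ω - a) 2 P)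
    (hlim : Tendsto (fun n => ∫ ω, (f n ω - a) ^ 2 ∂P) atTop (nhds 0)) :
    TendstoInMeasure P f atTop (fun _ => a) := by
  have hm : ∀ n, AEStronglyMeasurable (f n) P := fun n => by
    simpa using (hf n).1.add_const a
  refine tendstoInMeasure_of_tendsto_eLpNorm (p := 2) two_ne_zero hm (by fun_prop) ?_
  have : ∀ n, eLpNorm (f n - fun _ => a) 2 P
      = ENNReal.ofReal ((∫ ω, (f n ω - a) ^ 2 ∂P) ^ (1 / 2 : ℝ)) := by
    intro n
    have := (hf n).eLpNorm_eq_integral_rpow_norm two_ne_zero ENNReal.ofNat_ne_top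
    change eLpNorm (fun ω => f n ω - a) 2 P = _
    simpa using this
  simp_rw [this]
  rw [← ENNReal.ofReal_zero]
  refine (ENNReal.continuous_ofReal.tendsto 0).comp ?_
  have := hlim.rpow_const (p := 1 / 2) (Or.inr (by norm_num))
  simpa using this

lemma tendstoInMeasure_comp_continuous₂ {Ω : Type*} [MeasurableSpace Ω] {P : Measure Ω}
    [IsFiniteMeasure P] {f g : ℕ → Ω → ℝ} {a b : ℝ} (hfm : ∀ n, Measurable (f n))
    (hgm : ∀ n, Measurable (g n)) (hf : TendstoInMeasure P f atTop (fun _ => a))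
    (hg : TendstoInMeasure P g atTop (fun _ => b)) {F : ℝ × ℝ → ℝ} (hF : Continuous F) :
    TendstoInMeasure P (fun n ω => F (f n ω, g n ω)) atTop (fun _ => F (a, b)) := by
  have hm : ∀ n, AEStronglyMeasurable (fun ω => F (f n ω, g n ω)) P := fun n =>
    (hF.measurable.comp ((hfm n).prodMk (hgm n))).aestronglyMeasurable
  refine (exists_seq_tendstoInMeasure_atTop_iff hm).2 fun ns hns => ?_
  obtain ⟨ms, hms, h1⟩ := (hf.comp hns.tendsto_atTop).exists_seq_tendsto_ae
  obtain ⟨ks, hks, h2⟩ :=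
    (hg.comp (hns.tendsto_atTop.comp hms.tendsto_atTop)).exists_seq_tendsto_ae
  refine ⟨ms ∘ ks, hms.comp hks, ?_⟩
  filter_upwards [h1, h2] with ω h1 h2
  exact (hF.tendsto (a, b)).comp ((h1.comp hks.tendsto_atTop).prodMk_nhds h2)

lemma tendsto_integral_sq_weighted_sum {Ω : Type*} [MeasurableSpace Ω] (P : Measure Ω)
    {Z : ℝ → Ω → ℝ} (hZ : ∀ s, 0 ≤ s → MemLp (Z s) 2 P) {C : ℝ}
    (hC : ∀ s, 0 ≤ s → ∫ ω, Z s ω ^ 2 ∂P ≤ C)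
    (hcov : ∀ ε > 0, ∃ M : ℝ, ∀ s u, 0 ≤ s → 0 ≤ u → M ≤ |u - s| → |∫ ω, Z s ω * Z u ω ∂P| ≤ ε)
    {t : ℕ → ℕ → ℝ} (ht0 : ∀ N, t N 0 = 0) (htnn : ∀ N, ∀ k < N, 0 ≤ t N k)
    (ht : ∀ N, ∀ k < N, t N k ≤ t N (k + 1)) {Δ : ℕ → ℝ}
    (hΔ : ∀ N, ∀ k < N, t N (k + 1) - t N k ≤ Δ N)
    (hT : Tendsto (fun N => t N N) atTop atTop) {B : ℝ} (hB : ∀ᶠ N in atTop, Δ N ≤ B) :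
    Tendsto (fun N => ∫ ω, (∑ k ∈ Finset.range N,
      (t N (k + 1) - t N k) / t N N * Z (t N k) ω) ^ 2 ∂P) atTop (nhds 0) := by
  have hint : ∀ s u, 0 ≤ s → 0 ≤ u → Integrable (fun ω => Z s ω * Z u ω) P := fun s u hs hu =>
    (hZ s hs).integrable_mul (hZ u hu)
  have hbound : ∀ s u, 0 ≤ s → 0 ≤ u → |∫ ω, Z s ω * Z u ω ∂P| ≤ C := by
    intro s u hs hu
    have h1 : |∫ ω, Z s ω * Z u ω ∂P| ≤ ∫ ω, (Z s ω ^ 2 + Z u ω ^ 2) / 2 ∂P := by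
      rw [← norm_eq_abs]
      refine norm_integral_le_of_norm_le
        (((hZ s hs).integrable_sq.add (hZ u hu).integrable_sq).div_const 2)
        (Eventually.of_forall fun ω => ?_)
      rw [norm_eq_abs, abs_le]
      constructor <;> nlinarith [sq_nonneg (Z s ω + Z u ω), sq_nonneg (Z s ω - Z u ω)]
    rw [integral_div, integral_add (hZ s hs).integrable_sq (hZ u hu).integrable_sq] at h1
    linarith [hC s hs, hC u hu]
  have := tendsto_double_sum_zero ht0 ht hΔ hT hB
    (G := fun N j k => ∫ ω, Z (t N j) ω * Z (t N k) ω ∂P) (C := C)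
    (fun N j hj k hk => hbound _ _ (htnn N j hj) (htnn N k hk))
    (fun ε hε => by
      obtain ⟨M, hM⟩ := hcov ε hε
      exact ⟨M, fun N j hj k hk h => hM _ _ (htnn N j hj) (htnn N k hk) h⟩)
  refine this.congr fun N => ?_
  have hi : ∀ j ∈ Finset.range N, ∀ k ∈ Finset.range N, Integrable (fun ω =>
      (t N (j + 1) - t N j) / t N N * ((t N (k + 1) - t N k) / t N N)
        * (Z (t N j) ω * Z (t N k) ω)) P := fun j hj k hk =>
    (hint _ _ (htnn N j (Finset.mem_range.1 hj)) (htnn N k (Finset.mem_range.1 hk))).const_mul _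
  have hsq : ∀ ω, (∑ k ∈ Finset.range N, (t N (k + 1) - t N k) / t N N * Z (t N k) ω) ^ 2
      = ∑ j ∈ Finset.range N, ∑ k ∈ Finset.range N,
        (t N (j + 1) - t N j) / t N N * ((t N (k + 1) - t N k) / t N N)
          * (Z (t N j) ω * Z (t N k) ω) := fun ω => by
    rw [sq, Finset.sum_mul_sum]
    exact Finset.sum_congr rfl fun j _ => Finset.sum_congr rfl fun k _ => mul_mul_mul_comm _ _ _ _
  simp_rw [hsq]
  rw [integral_finsetSum _ fun j hj => integrable_finsetSum _ (hi j hj)]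
  refine Finset.sum_congr rfl fun j hj => ?_
  rw [integral_finsetSum _ (hi j hj)]
  refine Finset.sum_congr rfl fun k hk => ?_
  rw [integral_const_mul]

lemma integrable_sq_of_growth_gaussianReal {h : ℝ → ℝ} (hc : Continuous h) {K : ℝ}
    (hK : ∀ x, |h x| ≤ K * (1 + x ^ 2)) : Integrable (fun x => h x ^ 2) (gaussianReal 0 1) := by
  refine ((integrable_one_add_sq_pow_gaussianReal 2).const_mul (K ^ 2)).mono'
    (by fun_prop) (Eventually.of_forall fun x => ?_)
  rw [norm_of_nonneg (sq_nonneg _), ← mul_pow, ← sq_abs]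
  exact pow_le_pow_left₀ (abs_nonneg _) (hK x) 2

lemma tendstoInMeasure_weighted_sum {Ω : Type*} [MeasurableSpace Ω] (P : Measure Ω)
    [IsProbabilityMeasure P] {Y : ℝ → Ω → ℝ} (hY : ∀ s, Measurable (Y s))
    {r : ℝ → ℝ} (hreven : ∀ t, r (-t) = r t)
    (hlaw : ∀ s, 0 ≤ s → P.map (Y s) = gaussianReal 0 1)
    (hGauss : ∀ s t : ℝ, 0 ≤ s → 0 ≤ t → ∀ c d : ℝ,
      P.map (fun ω => c * Y s ω + d * Y t ω)
        = gaussianReal 0 (Real.toNNReal (c ^ 2 + d ^ 2 + 2 * c * d * r (t - s))))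
    (hrlim : Tendsto r atTop (nhds 0))
    {h : ℝ → ℝ} (hc : Continuous h) {K : ℝ} (hK : ∀ x, |h x| ≤ K * (1 + x ^ 2))
    {t : ℕ → ℕ → ℝ} (ht0 : ∀ N, t N 0 = 0) (htnn : ∀ N, ∀ k < N, 0 ≤ t N k)
    (ht : ∀ N, ∀ k < N, t N k ≤ t N (k + 1)) {Δ : ℕ → ℝ}
    (hΔ : ∀ N, ∀ k < N, t N (k + 1) - t N k ≤ Δ N)
    (hT : Tendsto (fun N => t N N) atTop atTop) {B : ℝ} (hB : ∀ᶠ N in atTop, Δ N ≤ B) :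
    TendstoInMeasure P (fun N ω => ∑ k ∈ Finset.range N,
      (t N (k + 1) - t N k) / t N N * h (Y (t N k) ω)) atTop
      (fun _ => ∫ x, h x ∂gaussianReal 0 1) := by
  set a := ∫ x, h x ∂gaussianReal 0 1 with ha
  set g : ℝ → ℝ := fun x => h x - a with hg
  have hgc : Continuous g := by fun_prop
  have hgK : ∀ x, |g x| ≤ (K + |a|) * (1 + x ^ 2) := fun x => by
    have := abs_sub (h x) a
    nlinarith [hK x, abs_nonneg a, sq_nonneg x, mul_nonneg (abs_nonneg a) (sq_nonneg x)]
  have hg2 := integrable_sq_of_growth_gaussianReal hgc hgK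
  have hh : ∀ s, 0 ≤ s → MemLp (fun ω => h (Y s ω)) 2 P := fun s hs => by
    refine (memLp_two_iff_integrable_sq
      (hc.measurable.comp (hY s)).aestronglyMeasurable).2 ?_
    have := integrable_sq_of_growth_gaussianReal hc hK
    rw [← hlaw s hs] at this
    exact this.comp_measurable (hY s)
  have hgL : ∀ s, 0 ≤ s → MemLp (fun ω => g (Y s ω)) 2 P := fun s hs =>
    (hh s hs).sub (memLp_const a)
  have hgint : ∫ x, g x ∂gaussianReal 0 1 = 0 := by
    have : Integrable h (gaussianReal 0 1) := by
      have := (memLp_two_iff_integrable_sq hc.aestronglyMeasurable).2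
        (integrable_sq_of_growth_gaussianReal hc hK)
      exact this.integrable one_le_two
    simp only [hg]
    rw [integral_sub this (integrable_const _)]
    simp [ha]
  have hκ := tendsto_integral_mul_gaussian_pair hgc hgK
  rw [hgint, zero_pow two_ne_zero] at hκ
  have hcov : ∀ ε > 0, ∃ M : ℝ, ∀ s u, 0 ≤ s → 0 ≤ u → M ≤ |u - s| →
      |∫ ω, g (Y s ω) * g (Y u ω) ∂P| ≤ ε := by
    intro ε hε
    have h1 := hκ.eventually (Metric.closedBall_mem_nhds (0 : ℝ) hε)
    have h2 : ∀ᶠ ρ : ℝ in nhds 0, ρ ∈ Metric.closedBall (0 : ℝ) 1 :=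
      Metric.closedBall_mem_nhds _ one_pos
    obtain ⟨M, hM⟩ := eventually_atTop.1 (hrlim.eventually (h1.and h2))
    refine ⟨M, fun s u hs hu hsu => ?_⟩
    have hr : r |u - s| = r (u - s) := by
      rcases abs_choice (u - s) with h | h <;> rw [h]
      exact hreven _
    obtain ⟨h3, h4⟩ := hM _ hsu
    rw [hr] at h3 h4
    simp only [Metric.mem_closedBall, dist_zero_right, norm_eq_abs] at h3 h4
    have hpair := map_prodMk_eq_of_gaussian_comb P (hY s) (hY u) h4 (hGauss s u hs hu)
    have hG : Continuous fun z : ℝ × ℝ => g z.1 * g z.2 := by fun_prop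
    have e1 := integral_map (μ := P) ((hY s).prodMk (hY u)).aemeasurable
      hG.aestronglyMeasurable
    rw [hpair, integral_map (by fun_prop) hG.aestronglyMeasurable] at e1
    rw [← e1]
    exact h3
  have hmain := tendsto_integral_sq_weighted_sum P (Z := fun s ω => g (Y s ω)) hgL
    (C := ∫ x, g x ^ 2 ∂gaussianReal 0 1) (fun s hs => by
      rw [← hlaw s hs, integral_map (hY s).aemeasurable (by fun_prop)]) hcov ht0 htnn ht hΔ hT hB
  refine tendstoInMeasure_of_tendsto_integral_sq P (fun N => ?_) (hmain.congr' ?_)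
  · exact (memLp_finsetSum _ fun k hk =>
      (hh _ (htnn N k (Finset.mem_range.1 hk))).const_mul _).sub (memLp_const a)
  · filter_upwards [hT.eventually_gt_atTop 0] with N hN
    simp only [hg, mul_sub, Finset.sum_sub_distrib, ← Finset.sum_mul]
    simp only [sum_weights_eq_one (ht0 N) hN, one_mul]

lemma tendsto_integral_rpow_moment_estimator {Ω : Type*} [MeasurableSpace Ω] (P : Measure Ω)
    [IsProbabilityMeasure P] {Y : ℝ → Ω → ℝ} (hY : ∀ s, Measurable (Y s))
    {r : ℝ → ℝ} (hreven : ∀ t, r (-t) = r t)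
    (hlaw : ∀ s, 0 ≤ s → P.map (Y s) = gaussianReal 0 1)
    (hGauss : ∀ s t : ℝ, 0 ≤ s → 0 ≤ t → ∀ c d : ℝ,
      P.map (fun ω => c * Y s ω + d * Y t ω)
        = gaussianReal 0 (Real.toNNReal (c ^ 2 + d ^ 2 + 2 * c * d * r (t - s))))
    (hrlim : Tendsto r atTop (nhds 0))
    {f : ℝ → ℝ} (hf : Continuous f) {L : ℝ} (hL : ∀ x, f x ^ 2 ≤ L * (1 + x ^ 2))
    {t : ℕ → ℕ → ℝ} (ht0 : ∀ N, t N 0 = 0) (htnn : ∀ N, ∀ k < N, 0 ≤ t N k)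
    (ht : ∀ N, ∀ k < N, t N k ≤ t N (k + 1)) {Δ : ℕ → ℝ}
    (hΔ : ∀ N, ∀ k < N, t N (k + 1) - t N k ≤ Δ N)
    (hT : Tendsto (fun N => t N N) atTop atTop) {B : ℝ} (hB : ∀ᶠ N in atTop, Δ N ≤ B)
    {F : ℝ × ℝ → ℝ} (hF : Continuous F) {D : ℝ} (hD : 0 ≤ D)
    (hFD : ∀ x y, x ^ 2 ≤ y → F (x, y) ^ 2 ≤ D * (1 + y))
    (hF0 : F (∫ x, f x ∂gaussianReal 0 1, ∫ x, f x ^ 2 ∂gaussianReal 0 1) = 0)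
    {p : ℝ} (hp : 1 ≤ p) :
    Tendsto (fun N => ∫ ω, |F (∑ k ∈ Finset.range N,
        (t N (k + 1) - t N k) / t N N * f (Y (t N k) ω),
      ∑ k ∈ Finset.range N, (t N (k + 1) - t N k) / t N N * f (Y (t N k) ω) ^ 2)| ^ p ∂P)
      atTop (nhds 0) := by
  have hL0 : 0 ≤ L := by nlinarith [hL 0, sq_nonneg (f 0)]
  have hfK : ∀ x, |f x| ≤ (1 + L) * (1 + x ^ 2) := fun x => by
    have h1 := hL x
    have h2 : |f x| ≤ 1 + f x ^ 2 := by
      rw [← sq_abs]; nlinarith [sq_nonneg (|f x| - 1)]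
    nlinarith [sq_nonneg x]
  have hf2K : ∀ x, |f x ^ 2| ≤ L * (1 + x ^ 2) := fun x => by
    rw [abs_of_nonneg (sq_nonneg _)]; exact hL x
  have hm1 : ∀ N, Measurable (fun ω => ∑ k ∈ Finset.range N,
      (t N (k + 1) - t N k) / t N N * f (Y (t N k) ω)) := fun N =>
    Finset.measurable_fun_sum _ fun k _ => (hf.measurable.comp (hY _)).const_mul _
  have hm2 : ∀ N, Measurable (fun ω => ∑ k ∈ Finset.range N,
      (t N (k + 1) - t N k) / t N N * f (Y (t N k) ω) ^ 2) := fun N =>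
    Finset.measurable_fun_sum _ fun k _ => ((hf.measurable.comp (hY _)).pow_const 2).const_mul _
  have hlim := tendstoInMeasure_comp_continuous₂ hm1 hm2
    (tendstoInMeasure_weighted_sum P hY hreven hlaw hGauss hrlim hf hfK ht0 htnn ht hΔ hT hB)
    (tendstoInMeasure_weighted_sum P hY hreven hlaw hGauss hrlim
      (h := fun x => f x ^ 2) (hf.pow 2) hf2K ht0 htnn ht hΔ
      hT hB) hF
  rw [hF0] at hlim
  obtain ⟨m, hm⟩ := exists_nat_ge (p + 1)
  have hFm : ∀ N, Measurable (fun ω => F (∑ k ∈ Finset.range N,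
        (t N (k + 1) - t N k) / t N N * f (Y (t N k) ω),
      ∑ k ∈ Finset.range N, (t N (k + 1) - t N k) / t N N * f (Y (t N k) ω) ^ 2)) := fun N =>
    hF.measurable.comp ((hm1 N).prodMk (hm2 N))
  refine tendsto_integral_rpow_of_bounded_moment P hFm hlim hp (m := m)
    (by linarith [(Nat.cast_nonneg m : (0 : ℝ) ≤ m)])
    (C := (D * (1 + L)) ^ m * ∫ x, (1 + x ^ 2) ^ m ∂gaussianReal 0 1) ?_
  filter_upwards [hT.eventually_gt_atTop 0] with N hN
  set w : ℕ → ℝ := fun k => (t N (k + 1) - t N k) / t N N with hw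
  have hw0 : ∀ k ∈ Finset.range N, 0 ≤ w k := fun k hk =>
    div_nonneg (sub_nonneg.2 (ht N k (Finset.mem_range.1 hk))) hN.le
  have hw1 : ∑ k ∈ Finset.range N, w k = 1 := sum_weights_eq_one (ht0 N) hN
  have hpt : ∀ ω, F (∑ k ∈ Finset.range N, w k * f (Y (t N k) ω),
      ∑ k ∈ Finset.range N, w k * f (Y (t N k) ω) ^ 2) ^ (2 * m)
      ≤ (D * (1 + L)) ^ m * ∑ k ∈ Finset.range N, w k * (1 + Y (t N k) ω ^ 2) ^ m := by
    intro ω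
    have h1 := hFD _ _ (pow_arith_mean_le_arith_mean_pow_of_even (Finset.range N) w
      (fun k => f (Y (t N k) ω)) hw0 hw1 even_two)
    have h2 := pow_arith_mean_le_arith_mean_pow (Finset.range N) w
      (fun k => 1 + Y (t N k) ω ^ 2) hw0 hw1 (fun _ _ => by positivity) m
    have h3 : 1 + ∑ k ∈ Finset.range N, w k * f (Y (t N k) ω) ^ 2
        ≤ (1 + L) * ∑ k ∈ Finset.range N, w k * (1 + Y (t N k) ω ^ 2) := by
      nth_rewrite 1 [← hw1]
      rw [← Finset.sum_add_distrib, Finset.mul_sum]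
      refine Finset.sum_le_sum fun k hk => ?_
      have := hL (Y (t N k) ω)
      have := mul_le_mul_of_nonneg_left (show 1 + f (Y (t N k) ω) ^ 2
        ≤ (1 + L) * (1 + Y (t N k) ω ^ 2) by nlinarith [sq_nonneg (Y (t N k) ω)]) (hw0 k hk)
      linarith
    rw [pow_mul]
    calc _ ≤ (D * (1 + L) * ∑ k ∈ Finset.range N, w k * (1 + Y (t N k) ω ^ 2)) ^ m := by
          refine pow_le_pow_left₀ (sq_nonneg _) (h1.trans ?_) m
          rw [mul_assoc]
          exact mul_le_mul_of_nonneg_left h3 hD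
      _ ≤ _ := by
          rw [mul_pow]
          exact mul_le_mul_of_nonneg_left h2 (by positivity)
  have hYi : ∀ k ∈ Finset.range N,
      Integrable (fun ω => w k * (1 + Y (t N k) ω ^ 2) ^ m) P := fun k hk => by
    have := integrable_one_add_sq_pow_gaussianReal m
    rw [← hlaw _ (htnn N k (Finset.mem_range.1 hk))] at this
    exact (this.comp_measurable (hY _)).const_mul _
  have hi := (integrable_finsetSum _ hYi).const_mul ((D * (1 + L)) ^ m)
  have hnn : ∀ ω, 0 ≤ F (∑ k ∈ Finset.range N, w k * f (Y (t N k) ω),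
      ∑ k ∈ Finset.range N, w k * f (Y (t N k) ω) ^ 2) ^ (2 * m) := fun ω => by
    rw [pow_mul]; positivity
  refine ⟨hi.mono' ((hFm N).pow_const _).aestronglyMeasurable (Eventually.of_forall fun ω => ?_), ?_⟩
  · rw [norm_of_nonneg (hnn ω)]; exact hpt ω
  · refine (integral_mono_of_nonneg (Eventually.of_forall hnn) hi
      (Eventually.of_forall hpt)).trans_eq ?_
    rw [integral_const_mul, integral_finsetSum _ hYi]
    congr 1
    rw [← one_mul (∫ x, (1 + x ^ 2) ^ m ∂gaussianReal 0 1), ← hw1, Finset.sum_mul]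
    refine Finset.sum_congr rfl fun k hk => ?_
    rw [integral_const_mul, ← hlaw _ (htnn N k (Finset.mem_range.1 hk)),
      integral_map (hY _).aemeasurable (by fun_prop)]

lemma integral_abs_add_id_gaussianReal (a b : ℝ) :
    √(π / 2) * ∫ x, (a * |x| + b * x) ∂gaussianReal 0 1 = a := by
  have hi : Integrable (fun x : ℝ => x) (gaussianReal 0 1) :=
    (memLp_id_gaussianReal (μ := 0) (v := 1) 1).integrable le_rfl
  rw [integral_add (hi.abs.const_mul a) (hi.const_mul b), integral_const_mul, integral_const_mul,
    integral_id_gaussianReal, mul_zero, add_zero, mul_left_comm, integral_abs_gaussianReal, mul_one]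

lemma integral_abs_add_id_sq_gaussianReal (a b : ℝ) :
    ∫ x, (a * |x| + b * x) ^ 2 ∂gaussianReal 0 1 = a ^ 2 + b ^ 2 := by
  have hi : Integrable (fun x : ℝ => x ^ 2) (gaussianReal 0 1) :=
    (memLp_id_gaussianReal (μ := 0) (v := 1) 2).integrable_sq
  have hi' : Integrable (fun x : ℝ => |x| * x) (gaussianReal 0 1) :=
    hi.mono' (by fun_prop) (Eventually.of_forall fun x => by simp [← sq])
  have : ∀ x : ℝ, (a * |x| + b * x) ^ 2 = (a ^ 2 + b ^ 2) * x ^ 2 + 2 * a * b * (|x| * x) := by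
    intro x
    rw [← sq_abs x]
    nlinarith [sq_abs x]
  simp_rw [this]
  rw [integral_add (hi.const_mul _) (hi'.const_mul _), integral_const_mul, integral_const_mul,
    integral_sq_gaussianReal, integral_eq_zero_of_odd_gaussianReal (by simp)]
  ring

/-- Theorem 3.9 (consistency based on discrete observations): if `r(T) → 0` as `T → ∞`,
`sup_{0≤s≤t} c(s) → 0` as `t → 0`, the horizons `T_N = t N N → ∞`, and the meshes
`Δ_N → 0`, then the discrete moment estimators `α̃₊(N)`, `α̃₋(N)` converge in `L^p`
to `α₊`, `α₋`. -/
theorem discrete_estimator_consistency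
    {Ω : Type*} [MeasurableSpace Ω] (P : Measure Ω) [IsProbabilityMeasure P]
    (Y : ℝ → Ω → ℝ) (hYmeas : Measurable (Function.uncurry Y))
    (r : ℝ → ℝ) (hreven : ∀ t, r (-t) = r t) (hr0 : r 0 = 1)
    (hGauss : ∀ s t : ℝ, 0 ≤ s → 0 ≤ t → ∀ c d : ℝ,
      P.map (fun ω => c * Y s ω + d * Y t ω)
        = gaussianReal 0 (Real.toNNReal (c ^ 2 + d ^ 2 + 2 * c * d * r (t - s))))
    (c : ℝ → ℝ) (hc : ∀ t, c t = 2 * (1 - r t))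
    (hrlim : Tendsto r atTop (nhds 0))
    (hclim : Tendsto (fun t : ℝ => ⨆ s ∈ Set.Icc (0 : ℝ) t, c s)
      (nhdsWithin 0 (Set.Ioi 0)) (nhds 0))
    (αp αm : ℝ) (hαp : 0 < αp) (hαm : 0 < αm) (hne : αp ≠ αm)
    (X : ℝ → Ω → ℝ)
    (hX : ∀ t ω, X t ω = αp * Y t ω * (if 0 < Y t ω then (1 : ℝ) else 0)
            + αm * Y t ω * (if Y t ω < 0 then (1 : ℝ) else 0))
    -- the partitions: for each `N`, `0 = t N 0 < t N 1 < ⋯ < t N N = T_N`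
    (t : ℕ → ℕ → ℝ) (ht0 : ∀ N, t N 0 = 0)
    (htmono : ∀ N, ∀ k < N, t N k < t N (k + 1))
    -- the meshes `Δ_N`
    (Δ : ℕ → ℝ) (hΔ : ∀ N, ∀ k < N, t N (k + 1) - t N k ≤ Δ N)
    (hT : Tendsto (fun N => t N N) atTop atTop)
    (hΔlim : Tendsto Δ atTop (nhds 0))
    -- the discrete moment estimators and the parameter estimators
    (m1 m2 : ℕ → Ω → ℝ)
    (hm1 : ∀ N ω, m1 N ω
      = (1 / t N N) * ∑ k ∈ Finset.range N, X (t N k) ω * (t N (k + 1) - t N k))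
    (hm2 : ∀ N ω, m2 N ω
      = (1 / t N N) * ∑ k ∈ Finset.range N, (X (t N k) ω) ^ 2 * (t N (k + 1) - t N k))
    (aPlus aMinus : ℕ → Ω → ℝ)
    (haPlus : ∀ N ω, aPlus N ω
      = Real.sqrt (π / 2) * m1 N ω
        + (1 / 2) * Real.sqrt |4 * m2 N ω - 2 * π * (m1 N ω) ^ 2|)
    (haMinus : ∀ N ω, aMinus N ω
      = -Real.sqrt (π / 2) * m1 N ω
        + (1 / 2) * Real.sqrt |4 * m2 N ω - 2 * π * (m1 N ω) ^ 2|)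
    (p : ℝ) (hp : 1 ≤ p) :
    Tendsto (fun N : ℕ => ∫ ω, |aPlus N ω - αp| ^ p ∂P) atTop (nhds 0)
    ∧ Tendsto (fun N : ℕ => ∫ ω, |aMinus N ω - αm| ^ p ∂P) atTop (nhds 0) := by
  have hY : ∀ s, Measurable (Y s) := fun s => hYmeas.comp measurable_prodMk_left
  have hlaw : ∀ s, 0 ≤ s → P.map (Y s) = gaussianReal 0 1 := fun s hs => by
    simpa using hGauss s s hs hs 1 0
  have htnn : ∀ N, ∀ k ≤ N, 0 ≤ t N k := by
    intro N k
    induction k with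
    | zero => intro _; rw [ht0]
    | succ k ih => intro hk; exact (ih (by omega)).trans (htmono N k hk).le
  set a := (αp - αm) / 2 with ha
  set b := (αp + αm) / 2 with hb
  have hXf : ∀ s ω, X s ω = a * |Y s ω| + b * Y s ω := by
    intro s ω
    rw [hX]
    rcases lt_trichotomy (Y s ω) 0 with h | h | h
    · simp only [h, not_lt_of_gt h, if_true, if_false, abs_of_neg h, ha, hb]; ring
    · simp [h]
    · simp only [h, not_lt_of_gt h, if_true, if_false, abs_of_pos h, ha, hb]; ring
  have hm1' : ∀ N ω, m1 N ω = ∑ k ∈ Finset.range N,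
      (t N (k + 1) - t N k) / t N N * (a * |Y (t N k) ω| + b * Y (t N k) ω) := by
    intro N ω
    rw [hm1, Finset.mul_sum]
    refine Finset.sum_congr rfl fun k _ => ?_
    rw [hXf]; ring
  have hm2' : ∀ N ω, m2 N ω = ∑ k ∈ Finset.range N,
      (t N (k + 1) - t N k) / t N N * (a * |Y (t N k) ω| + b * Y (t N k) ω) ^ 2 := by
    intro N ω
    rw [hm2, Finset.mul_sum]
    refine Finset.sum_congr rfl fun k _ => ?_
    rw [hXf]; ring
  have hf2 : ∀ x : ℝ, (a * |x| + b * x) ^ 2 ≤ (2 * a ^ 2 + 2 * b ^ 2) * (1 + x ^ 2) := by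
    intro x
    have h1 : (a * |x| + b * x) ^ 2 + (a * |x| - b * x) ^ 2
        = (2 * a ^ 2 + 2 * b ^ 2) * x ^ 2 := by
      rw [← sq_abs x]; nlinarith [sq_abs x]
    nlinarith [sq_nonneg (a * |x| - b * x), sq_nonneg a, sq_nonneg b]
  have hμ1 := integral_abs_add_id_gaussianReal a b
  have hμ2 := integral_abs_add_id_sq_gaussianReal a b
  have hs2 : √(π / 2) ^ 2 = π / 2 := Real.sq_sqrt (by positivity)
  have key : ∀ σ α : ℝ, σ ^ 2 = 1 → σ * a + b = α →
      Tendsto (fun N : ℕ => ∫ ω, |σ * √(π / 2) * m1 N ω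
        + (1 / 2) * √|4 * m2 N ω - 2 * π * (m1 N ω) ^ 2| - α| ^ p ∂P) atTop (nhds 0) := by
    intro σ α hσ hα
    have := tendsto_integral_rpow_moment_estimator P hY hreven hlaw hGauss hrlim
      (f := fun x => a * |x| + b * x) (by fun_prop) hf2 ht0 (fun N k hk => htnn N k hk.le)
      (fun N k hk => (htmono N k hk).le) hΔ hT (hΔlim.eventually_le_const one_pos)
      (F := fun z => σ * √(π / 2) * z.1 + (1 / 2) * √|4 * z.2 - 2 * π * z.1 ^ 2| - α)
      (by fun_prop) (D := 15 + 3 * α ^ 2) (by positivity) ?_ ?_ hp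
    · simpa only [← hm1', ← hm2'] using this
    · intro x y hxy
      have hy : 0 ≤ y := (sq_nonneg x).trans hxy
      have hA : (σ * √(π / 2) * x) ^ 2 ≤ 2 * y := by
        rw [mul_pow, mul_pow, hσ, hs2]
        nlinarith [pi_le_four, pi_pos, sq_nonneg x]
      have hB : (1 / 2 * √|4 * y - 2 * π * x ^ 2|) ^ 2 ≤ 3 * y := by
        rw [mul_pow, Real.sq_sqrt (abs_nonneg _)]
        have : |4 * y - 2 * π * x ^ 2| ≤ 12 * y := by
          rw [abs_le]
          constructor <;> nlinarith [pi_le_four, pi_pos, sq_nonneg x]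
        linarith
      simp only
      set A := σ * √(π / 2) * x
      set E := 1 / 2 * √|4 * y - 2 * π * x ^ 2|
      nlinarith [sq_nonneg (A - E), sq_nonneg (A + α), sq_nonneg (E + α), sq_nonneg α,
        mul_nonneg (sq_nonneg α) hy]
    · simp only
      rw [hμ2, mul_assoc, hμ1]
      set μ := ∫ x, (a * |x| + b * x) ∂gaussianReal 0 1
      have h1 : 2 * π * μ ^ 2 = 4 * a ^ 2 := by
        rw [← hμ1, mul_pow, hs2]; ring
      have h2 : 0 ≤ 2 * b := by rw [hb]; linarith
      rw [h1, show 4 * (a ^ 2 + b ^ 2) - 4 * a ^ 2 = (2 * b) ^ 2 by ring,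
        abs_of_nonneg (sq_nonneg _), Real.sqrt_sq h2, ← hα]
      ring
  constructor
  · simpa only [haPlus, one_mul] using key 1 αp (by norm_num) (by rw [ha, hb]; ring)
  · simpa only [haMinus, neg_mul, one_mul] using
      key (-1) αm (by norm_num) (by rw [ha, hb]; ring)
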